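/- Let m ≥ 3, V = 2^m, let tokens be identified with binary vectors in {0,1}^m, let β > 0 and 0 < ε < 1. Fix b > 0 and a with 0 < a < 2·exp(1/β)/((V−2)·m²). Then there exist B₀ and a threshold L₀ (depending on m, β, ε, a, b) such that the following holds: for all b₀ ≥ B₀ and all L ≥ L₀, if the embeddings W_E(t) ∈ ℝ^d satisfy the embedding geometry ⟨W_E(t), W_E(t)⟩ = b₀ for all t and ⟨W_E(t), W_E(t')⟩ = −a·D_H(t,t') + b for all t ≠ t', W_V = Σ_t W_E(t)(Σ_{t'∈N1(t)} W_E(t')ᵀ) is the constructed value matrix, the logits are f_t(x) = W_E(t)ᵀ W_V ((1/L)Σ_{l=1}^L W_E(x_l)), and the context tokens x_1,…,x_L are drawn i.i.d. from the informative conditional distribution π(·|y), then for every token y the probability that there exists t ≠ y with f_t(x) ≥ f_y(x) is at most ε. -/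

import Mathlib

open Matrix
open scoped Classical

lemma sum_biUnion_le_H {ι κ : Type*} [DecidableEq κ] (s : Finset ι) (T : ι → Finset κ) (g : κ → ℝ)
    (hg : ∀ x, 0 ≤ g x) : ∑ x ∈ s.biUnion T, g x ≤ ∑ i ∈ s, ∑ x ∈ T i, g x := by
  induction s using Finset.induction_on with
  | empty => simp
  | insert i s hi ih =>
    rw [Finset.biUnion_insert, Finset.sum_insert hi]
    have h1 := Finset.sum_union_inter (s₁ := T i) (s₂ := s.biUnion T) (f := g)
    have h2 : 0 ≤ ∑ x ∈ T i ∩ s.biUnion T, g x := Finset.sum_nonneg fun x _ => hg x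
    linarith

noncomputable def adjH {m : ℕ} (t z : Fin m → Bool) : ℝ := if hammingDist t z = 1 then 1 else 0

lemma adjH_abs {m : ℕ} (t z : Fin m → Bool) : |adjH t z| ≤ 1 := by
  unfold adjH; split_ifs <;> simp

lemma sum_adjH {m : ℕ} (t y : Fin m → Bool) : ∑ z, adjH t z = ∑ z, adjH y z := by
  let F : (Fin m → Bool) → (Fin m → Bool) := fun z i => xor (z i) (xor (y i) (t i))
  have hF : Function.Involutive F := by
    intro z; funext i; simp only [F]
    cases z i <;> cases y i <;> cases t i <;> rfl
  refine Fintype.sum_equiv hF.toPerm _ _ ?_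
  intro z
  have : hammingDist t z = hammingDist y (F z) := by
    unfold hammingDist
    congr 1
    ext i
    simp only [F, Finset.mem_filter, Finset.mem_univ, true_and]
    cases z i <;> cases y i <;> cases t i <;> simp
  change adjH t z = adjH y (F z)
  unfold adjH
  rw [this]

lemma exists_nbr {m : ℕ} (hm : 3 ≤ m) (t y : Fin m → Bool) (h : t ≠ y) :
    ∃ z, hammingDist t z = 1 ∧ hammingDist y z ≠ 1 := by
  have key : ∀ i, hammingDist t (Function.update t i (!t i)) = 1 := by
    intro i
    unfold hammingDist
    rw [Finset.card_eq_one]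
    refine ⟨i, ?_⟩
    ext j
    by_cases hj : j = i
    · subst hj; simp
    · simp [hj]
  have two : ∀ i j k z, j ≠ k → z = Function.update t i (!t i) → y j ≠ z j → y k ≠ z k →
      hammingDist y z ≠ 1 := by
    intro i j k z hjk _ h1 h2
    have : 1 < hammingDist y z := by
      unfold hammingDist
      rw [Finset.one_lt_card]
      exact ⟨j, by simp [h1], k, by simp [h2], hjk⟩
    omega
  by_cases hc : ∃ i, t i = y i
  · obtain ⟨i, hi⟩ := hc
    obtain ⟨j, hj⟩ := Function.ne_iff.mp h
    have hij : j ≠ i := by rintro rfl; exact hj hi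
    refine ⟨_, key i, two i i j _ hij.symm rfl ?_ ?_⟩
    · simp [hi]
    · simp [hij, hj.symm]
  · push Not at hc
    let i : Fin m := ⟨0, by omega⟩
    let j : Fin m := ⟨1, by omega⟩
    let k : Fin m := ⟨2, by omega⟩
    have hji : j ≠ i := by simp [i, j]
    have hki : k ≠ i := by simp [i, k]
    have hjk : j ≠ k := by simp [k, j]
    refine ⟨_, key i, two i j k _ hjk rfl ?_ ?_⟩
    · simp [hji, (hc j).symm]
    · simp [hki, (hc k).symm]

/-- Chernoff-type bound for finite i.i.d. sums. -/
lemma chernoff {Ω : Type*} [Fintype Ω] (p g : Ω → ℝ) (hp : ∀ z, 0 ≤ p z) (hs : ∑ z, p z = 1)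
    (hg : ∀ z, |g z| ≤ 2) (hpos : 0 < ∑ z, p z * g z) (ε : ℝ) (hε : 0 < ε) :
    ∀ᶠ δ in nhdsWithin (0:ℝ) (Set.Ioi 0), ∀ᶠ L : ℕ in Filter.atTop,
      ∑ x ∈ Finset.univ.filter (fun x : Fin L → Ω => ∑ l, g (x l) ≤ L * δ), ∏ l, p (x l) ≤ ε := by
  set μ := ∑ z, p z * g z with hμ
  have hμ2 : μ ≤ 2 := by
    calc μ ≤ ∑ z, p z * 2 := Finset.sum_le_sum fun z _ =>
          mul_le_mul_of_nonneg_left (abs_le.mp (hg z)).2 (hp z)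
      _ = 2 := by rw [← Finset.sum_mul, hs, one_mul]
  have hmem : Set.Ioo (0:ℝ) (μ / 2) ∈ nhdsWithin (0:ℝ) (Set.Ioi 0) := Ioo_mem_nhdsGT (by linarith)
  filter_upwards [hmem] with δ hδ
  obtain ⟨hδ0, hδ1⟩ := hδ
  set s := μ / 32 with hsd
  have hs0 : 0 < s := by positivity
  set r := ∑ z, p z * Real.exp (s * (δ - g z)) with hr
  have hr0 : 0 ≤ r := Finset.sum_nonneg fun z _ => mul_nonneg (hp z) (Real.exp_pos _).le
  have hr1 : r < 1 := by
    have h1 : r ≤ ∑ z, (p z * (1 + s * δ + 9 * s ^ 2) - s * (p z * g z)) := by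
      refine Finset.sum_le_sum fun z _ => ?_
      have ha := abs_le.mp (hg z)
      have hu : |δ - g z| ≤ 3 := by rw [abs_le]; constructor <;> linarith
      have hu1 : |s * (δ - g z)| ≤ 1 := by
        rw [abs_mul, abs_of_pos hs0]; nlinarith
      have h2 := (abs_le.mp (Real.abs_exp_sub_one_sub_id_le hu1)).2
      have h3 : (δ - g z) ^ 2 ≤ 9 := by
        have := abs_le.mp hu; nlinarith
      have h4 : Real.exp (s * (δ - g z)) ≤ 1 + s * δ + 9 * s ^ 2 - s * g z := by
        have : (s * (δ - g z)) ^ 2 ≤ 9 * s ^ 2 := by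
          rw [mul_pow]; nlinarith [sq_nonneg s]
        linarith
      have := mul_le_mul_of_nonneg_left h4 (hp z)
      linarith
    rw [Finset.sum_sub_distrib, ← Finset.sum_mul, hs, ← Finset.mul_sum, ← hμ] at h1
    nlinarith
  have hlim := tendsto_pow_atTop_nhds_zero_of_lt_one hr0 hr1
  filter_upwards [hlim.eventually (ge_mem_nhds hε)] with L hL
  refine le_trans ?_ hL
  calc _ ≤ ∑ x ∈ Finset.univ.filter (fun x : Fin L → Ω => ∑ l, g (x l) ≤ L * δ),
            ∏ l, (p (x l) * Real.exp (s * (δ - g (x l)))) := by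
        refine Finset.sum_le_sum fun x hx => ?_
        rw [Finset.prod_mul_distrib, ← Real.exp_sum]
        refine le_mul_of_one_le_right (Finset.prod_nonneg fun l _ => hp _) ?_
        rw [Real.one_le_exp_iff, ← Finset.mul_sum, Finset.sum_sub_distrib]
        have := (Finset.mem_filter.mp hx).2
        simp only [Finset.sum_const, Finset.card_univ, Fintype.card_fin, nsmul_eq_mul]
        exact mul_nonneg hs0.le (by linarith)
    _ ≤ ∑ x : Fin L → Ω, ∏ l, (p (x l) * Real.exp (s * (δ - g (x l)))) :=
        Finset.sum_le_sum_of_subset_of_nonneg (Finset.filter_subset _ _) fun x _ _ =>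
          Finset.prod_nonneg fun l _ => mul_nonneg (hp _) (Real.exp_pos _).le
    _ = r ^ L := by
        rw [hr, Finset.sum_pow']
        simp

noncomputable def piH {m : ℕ} (β : ℝ) (y z : Fin m → Bool) : ℝ :=
  if z = y then 0 else
    Real.exp (-(hammingDist z y : ℝ) / β) /
      ∑ z' ∈ Finset.univ.filter (fun z' : Fin m → Bool => z' ≠ y),
        Real.exp (-(hammingDist z' y : ℝ) / β)

lemma Zpos {m : ℕ} (hm : 3 ≤ m) (β : ℝ) (y : Fin m → Bool) :
    0 < ∑ z' ∈ Finset.univ.filter (fun z' : Fin m → Bool => z' ≠ y),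
        Real.exp (-(hammingDist z' y : ℝ) / β) := by
  refine Finset.sum_pos (fun _ _ => Real.exp_pos _) ⟨fun i => !y i, ?_⟩
  simp only [Finset.mem_filter, Finset.mem_univ, true_and]
  intro h
  have := congrFun h ⟨0, by omega⟩
  simp at this

lemma piH_nonneg {m : ℕ} (hm : 3 ≤ m) (β : ℝ) (y z : Fin m → Bool) : 0 ≤ piH β y z := by
  unfold piH
  split_ifs
  · exact le_rfl
  · exact div_nonneg (Real.exp_pos _).le (Zpos hm β y).le

lemma piH_sum {m : ℕ} (hm : 3 ≤ m) (β : ℝ) (y : Fin m → Bool) : ∑ z, piH β y z = 1 := by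
  have h := Zpos hm β y
  rw [← div_self h.ne', Finset.sum_div, Finset.sum_filter]
  refine Finset.sum_congr rfl fun z _ => ?_
  unfold piH
  by_cases hz : z = y <;> simp [hz]

lemma piH_gap {m : ℕ} (hm : 3 ≤ m) (β : ℝ) (hβ : 0 < β) (t y : Fin m → Bool) (h : t ≠ y) :
    0 < ∑ z, piH β y z * (adjH y z - adjH t z) := by
  have hZ := Zpos hm β y
  set Z := ∑ z' ∈ Finset.univ.filter (fun z' : Fin m → Bool => z' ≠ y),
        Real.exp (-(hammingDist z' y : ℝ) / β) with hZd
  set q := Real.exp (-1 / β) / Z with hq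
  have h1 : ∑ z, piH β y z * (adjH y z - adjH t z)
      = ∑ z, (piH β y z - q) * (adjH y z - adjH t z) := by
    simp only [sub_mul _ q]
    rw [Finset.sum_sub_distrib, ← Finset.mul_sum (f := fun z => adjH y z - adjH t z),
      Finset.sum_sub_distrib, sum_adjH t y]
    simp
  have heq : ∀ z, hammingDist y z = 1 → piH β y z = q := by
    intro z hz
    have hzy : z ≠ y := by rintro rfl; simp at hz
    rw [hammingDist_comm] at hz
    simp only [piH, hzy, if_false, hz, hq, ← hZd]
    simp
  have hlt : ∀ z, hammingDist y z ≠ 1 → piH β y z < q := by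
    intro z hz
    by_cases hzy : z = y
    · simp only [piH, hzy, if_true]; exact div_pos (Real.exp_pos _) hZ
    · rw [hammingDist_comm] at hz
      have h0 : hammingDist z y ≠ 0 := hammingDist_ne_zero.mpr hzy
      have h2 : 1 < hammingDist z y := by omega
      have h3 : (1:ℝ) < hammingDist z y := by exact_mod_cast h2
      simp only [piH, hzy, if_false, hq, ← hZd]
      refine div_lt_div_of_pos_right ?_ hZ
      exact Real.exp_lt_exp.mpr (div_lt_div_of_pos_right (by linarith) hβ)
  rw [h1]
  obtain ⟨z₀, hz1, hz2⟩ := exists_nbr hm t y h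
  refine Finset.sum_pos' (fun z _ => ?_) ⟨z₀, Finset.mem_univ _, ?_⟩
  · by_cases hz : hammingDist y z = 1
    · rw [heq z hz]; simp
    · have := hlt z hz
      have h5 : 0 ≤ adjH t z := by unfold adjH; split_ifs <;> simp
      have h6 : adjH y z = 0 := by simp [adjH, hz]
      rw [h6]; nlinarith
  · have := hlt z₀ hz2
    have h5 : adjH t z₀ = 1 := by simp [adjH, hz1]
    have h6 : adjH y z₀ = 0 := by simp [adjH, hz2]
    rw [h5, h6]; linarith

/-- Logit expansion. -/
lemma logit_eq {m d L : ℕ} (WE : (Fin m → Bool) → (Fin d → ℝ)) (t : Fin m → Bool)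
    (x : Fin L → (Fin m → Bool)) :
    WE t ⬝ᵥ (∑ t : Fin m → Bool, Matrix.vecMulVec (WE t)
              (∑ t' ∈ Finset.univ.filter
                  (fun t' : Fin m → Bool => hammingDist t t' = 1), WE t')).mulVec
                  ((L : ℝ)⁻¹ • ∑ l : Fin L, WE (x l))
      = (L : ℝ)⁻¹ * ∑ l, ∑ s, ∑ s', adjH s s' * ((WE t ⬝ᵥ WE s) * (WE s' ⬝ᵥ WE (x l))) := by
  rw [Matrix.mulVec_smul, dotProduct_smul, smul_eq_mul]
  congr 1
  rw [Matrix.mulVec_sum, dotProduct_sum]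
  refine Finset.sum_congr rfl fun l _ => ?_
  rw [Matrix.sum_mulVec, dotProduct_sum]
  refine Finset.sum_congr rfl fun s _ => ?_
  rw [Matrix.vecMulVec_mulVec, sum_dotProduct, Finset.sum_filter]
  simp only [op_smul_eq_smul, dotProduct_smul, smul_eq_mul, Finset.sum_mul]
  refine Finset.sum_congr rfl fun s' _ => ?_
  unfold adjH
  split_ifs
  · ring
  · simp

lemma quad_bound {m : ℕ} (M c : ℝ) (hM : 0 ≤ M) (hc : 1 ≤ c)
    (G : (Fin m → Bool) → (Fin m → Bool) → ℝ)
    (hG : ∀ s s', |G s s' - (if s = s' then c else 0)| ≤ M) (t z : Fin m → Bool) :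
    |∑ s, ∑ s', adjH s s' * (G t s * G s' z) - c ^ 2 * adjH t z|
      ≤ (2 * 2 ^ m * M + (2 ^ m * M) ^ 2) * c := by
  set E : (Fin m → Bool) → (Fin m → Bool) → ℝ := fun s s' => G s s' - (if s = s' then c else 0)
    with hE
  have hGE : ∀ s s', G s s' = (if s = s' then c else 0) + E s s' := fun s s' => by simp [hE]
  have hEM : ∀ s s', |E s s'| ≤ M := hG
  have hexp : ∑ s, ∑ s', adjH s s' * (G t s * G s' z) - c ^ 2 * adjH t z
      = c * ∑ s', adjH t s' * E s' z + c * ∑ s, adjH s z * E t s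
        + ∑ s, ∑ s', adjH s s' * (E t s * E s' z) := by
    have : ∀ s s', adjH s s' * (G t s * G s' z) =
        (if t = s then (if s' = z then c ^ 2 * adjH s s' else 0) else 0)
        + (if t = s then c * (adjH s s' * E s' z) else 0)
        + (if s' = z then c * (adjH s s' * E t s) else 0)
        + adjH s s' * (E t s * E s' z) := by
      intro s s'
      rw [hGE t s, hGE s' z]
      split_ifs <;> ring
    simp only [this, Finset.sum_add_distrib]
    rw [Finset.sum_comm (f := fun s s' => if t = s then c * (adjH s s' * E s' z) else 0)]
    have e1 : ∑ s, ∑ s', (if t = s then (if s' = z then c ^ 2 * adjH s s' else 0) else 0)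
        = c ^ 2 * adjH t z := by
      rw [Finset.sum_eq_single t]
      · simp
      · intro s _ hs; simp [hs.symm]
      · simp
    rw [e1]
    simp only [Finset.sum_ite_eq, Finset.sum_ite_eq', Finset.mem_univ, if_true, ← Finset.mul_sum]
    ring
  have hcard : (Finset.univ : Finset (Fin m → Bool)).card = 2 ^ m := by simp
  have hsum : ∀ (F : (Fin m → Bool) → ℝ) (K : ℝ), (∀ s, |F s| ≤ K) → |∑ s, F s| ≤ 2 ^ m * K := by
    intro F K hF
    calc |∑ s, F s| ≤ ∑ s, |F s| := Finset.abs_sum_le_sum_abs _ _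
      _ ≤ ∑ s : Fin m → Bool, K := Finset.sum_le_sum fun s _ => hF s
      _ = 2 ^ m * K := by rw [Finset.sum_const, hcard]; simp
  have hb1 : ∀ u v w w' : (Fin m → Bool), |adjH u v * E w w'| ≤ M := by
    intro u v w w'
    rw [abs_mul]
    nlinarith [adjH_abs u v, hEM w w', abs_nonneg (adjH u v), abs_nonneg (E w w')]
  have B1 := hsum (fun s' => adjH t s' * E s' z) M (fun s' => hb1 _ _ _ _)
  have B2 := hsum (fun s => adjH s z * E t s) M (fun s' => hb1 _ _ _ _)
  have B3 := hsum (fun s => ∑ s', adjH s s' * (E t s * E s' z)) (2 ^ m * (M * M)) (fun s =>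
    hsum _ _ (fun s' => by
      rw [← mul_assoc, abs_mul]
      exact mul_le_mul (hb1 _ _ _ _) (hEM _ _) (abs_nonneg _) hM))
  rw [hexp]
  have hc0 : 0 ≤ c := by linarith
  have hN : (0:ℝ) ≤ (2 ^ m * M) ^ 2 := sq_nonneg _
  rw [abs_le] at B1 B2 B3 ⊢
  constructor <;> nlinarith [mul_le_mul_of_nonneg_left B1.1 hc0, mul_le_mul_of_nonneg_left B1.2 hc0,
    mul_le_mul_of_nonneg_left B2.1 hc0, mul_le_mul_of_nonneg_left B2.2 hc0,
    mul_le_mul_of_nonneg_left hc hN]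

/-- Let `m ≥ 3`, `V = 2^m`, tokens be binary vectors in `{0,1}^m`, `β > 0`,
`0 < ε < 1`, `b > 0` and `0 < a < 2·exp(1/β)/((V−2)·m²)`. Then there exist `B₀` and `L₀` such
that for all `b₀ ≥ B₀` and `L ≥ L₀`: whenever embeddings `W_E(t) ∈ ℝ^d` satisfy the geometry
`⟨W_E(t), W_E(t)⟩ = b₀` and `⟨W_E(t), W_E(t')⟩ = −a·D_H(t,t') + b` for `t ≠ t'`, `W_V` is the
constructed value matrix, the logits are `f_t(x) = W_E(t)ᵀ W_V ((1/L)Σ_l W_E(x_l))`, and the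
context tokens are i.i.d. draws from the informative conditional distribution `π(·|y)`, then
for every token `y` the probability that some `t ≠ y` has `f_t(x) ≥ f_y(x)` is at most `ε`. -/
theorem stmt_6 (m : ℕ) (hm : 3 ≤ m) (β ε a b : ℝ) (hβ : 0 < β)
    (hε0 : 0 < ε) (hε1 : ε < 1) (hb : 0 < b) (ha0 : 0 < a)
    (ha1 : a < 2 * Real.exp (1 / β) / ((((2 : ℝ) ^ m) - 2) * (m : ℝ) ^ 2)) :
    ∃ (B₀ : ℝ) (L₀ : ℕ), ∀ b₀ : ℝ, B₀ ≤ b₀ → ∀ L : ℕ, L₀ ≤ L →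
      ∀ (d : ℕ) (WE : (Fin m → Bool) → (Fin d → ℝ)),
        (∀ t : Fin m → Bool, WE t ⬝ᵥ WE t = b₀) →
        (∀ t t' : Fin m → Bool, t ≠ t' →
          WE t ⬝ᵥ WE t' = -a * (hammingDist t t' : ℝ) + b) →
        ∀ y : Fin m → Bool,
          let π : (Fin m → Bool) → ℝ := fun z =>
            if z = y then 0 else
              Real.exp (-(hammingDist z y : ℝ) / β) /
                ∑ z' ∈ Finset.univ.filter (fun z' : Fin m → Bool => z' ≠ y),
                  Real.exp (-(hammingDist z' y : ℝ) / β)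
          let WV : Matrix (Fin d) (Fin d) ℝ :=
            ∑ t : Fin m → Bool, Matrix.vecMulVec (WE t)
              (∑ t' ∈ Finset.univ.filter
                  (fun t' : Fin m → Bool => hammingDist t t' = 1), WE t')
          let f : (Fin m → Bool) → (Fin L → (Fin m → Bool)) → ℝ :=
            fun t x => WE t ⬝ᵥ WV.mulVec ((L : ℝ)⁻¹ • ∑ l : Fin L, WE (x l))
          ∑ x ∈ Finset.univ.filter
              (fun x : Fin L → (Fin m → Bool) => ∃ t, t ≠ y ∧ f y x ≤ f t x),
            ∏ l : Fin L, π (x l) ≤ ε := by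
  have hev : ∀ᶠ δ in nhdsWithin (0:ℝ) (Set.Ioi 0), ∀ y t : Fin m → Bool, t ≠ y →
      ∀ᶠ L : ℕ in Filter.atTop,
      ∑ x ∈ Finset.univ.filter (fun x : Fin L → (Fin m → Bool) =>
        ∑ l, (adjH y (x l) - adjH t (x l)) ≤ L * δ), ∏ l, piH β y (x l) ≤ ε / 2 ^ m := by
    rw [Filter.eventually_all]; intro y
    rw [Filter.eventually_all]; intro t
    by_cases h : t = y
    · simp [h]
    · filter_upwards [chernoff (piH β y) (fun z => adjH y z - adjH t z) (piH_nonneg hm β y)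
        (piH_sum hm β y) (fun z => by
          have h1 := abs_le.mp (adjH_abs y z)
          have h2 := abs_le.mp (adjH_abs t z)
          rw [abs_le]; constructor <;> linarith) (piH_gap hm β hβ t y h) (ε / 2 ^ m)
          (by positivity)] with δ hδ _
      exact hδ
  obtain ⟨δ, hδ, hδ0⟩ := (hev.and self_mem_nhdsWithin).exists
  have hδ0 : 0 < δ := hδ0
  have hev2 : ∀ᶠ L : ℕ in Filter.atTop, ∀ y t : Fin m → Bool, t ≠ y →
      ∑ x ∈ Finset.univ.filter (fun x : Fin L → (Fin m → Bool) =>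
        ∑ l, (adjH y (x l) - adjH t (x l)) ≤ L * δ), ∏ l, piH β y (x l) ≤ ε / 2 ^ m := by
    rw [Filter.eventually_all]; intro y
    rw [Filter.eventually_all]; intro t
    rw [Filter.eventually_all]; intro h
    exact hδ y t h
  obtain ⟨L₀, hL₀⟩ := Filter.eventually_atTop.mp hev2
  set M : ℝ := a * m + b with hM
  have hM0 : 0 ≤ M := by positivity
  set R : ℝ := 2 * 2 ^ m * M + (2 ^ m * M) ^ 2 with hR
  refine ⟨b + max 1 (2 * R / δ), max 1 L₀, ?_⟩
  intro b₀ hb₀ L hL d WE hd ho y π WV f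
  set c := b₀ - b with hc
  have hc1 : 1 ≤ c := by have := le_max_left 1 (2 * R / δ); linarith
  have hc2 : 2 * R ≤ c * δ := by
    have := le_max_right 1 (2 * R / δ)
    rw [← div_le_iff₀ hδ0]; linarith
  have hLpos : (0:ℝ) < L := by
    have : 1 ≤ L := le_trans (le_max_left _ _) hL
    exact_mod_cast this
  have hG : ∀ s s', |WE s ⬝ᵥ WE s' - (if s = s' then c else 0)| ≤ M := by
    intro s s'
    by_cases h : s = s'
    · subst h
      rw [hd, if_pos rfl, hc, sub_sub_cancel, abs_of_pos hb, hM]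
      have : 0 ≤ a * m := by positivity
      linarith
    · rw [ho s s' h, if_neg h, sub_zero, hM]
      have h1 : (hammingDist s s' : ℝ) ≤ m := by
        have := hammingDist_le_card_fintype (x := s) (y := s')
        rw [Fintype.card_fin] at this
        exact_mod_cast this
      have h2 : (0:ℝ) ≤ hammingDist s s' := Nat.cast_nonneg _
      rw [abs_le]; constructor <;> nlinarith
  have hQ := quad_bound M c hM0 hc1 (fun s s' => WE s ⬝ᵥ WE s') hG
  have hdet : ∀ x : Fin L → (Fin m → Bool), ∀ t, f y x ≤ f t x →
      ∑ l, (adjH y (x l) - adjH t (x l)) ≤ L * δ := by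
    intro x t hft
    simp only [f, WV] at hft
    rw [logit_eq, logit_eq] at hft
    have h1 := le_of_mul_le_mul_left hft (inv_pos.mpr hLpos)
    have h2 : ∑ l, (c ^ 2 * (adjH y (x l) - adjH t (x l)) - 2 * R * c) ≤ 0 := by
      rw [← sub_nonpos, ← Finset.sum_sub_distrib] at h1
      refine le_trans (Finset.sum_le_sum fun l _ => ?_) h1
      have e1 := abs_le.mp (hQ y (x l))
      have e2 := abs_le.mp (hQ t (x l))
      rw [← hR] at e1 e2
      linarith [e1.1, e2.2]
    rw [Finset.sum_sub_distrib, ← Finset.mul_sum] at h2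
    simp only [Finset.sum_const, Finset.card_univ, Fintype.card_fin, nsmul_eq_mul] at h2
    set S := ∑ l, (adjH y (x l) - adjH t (x l)) with hS
    have hcc : 0 < c ^ 2 := by positivity
    refine le_of_mul_le_mul_left ?_ hcc
    have h3 := mul_le_mul_of_nonneg_left hc2 (by positivity : 0 ≤ (L:ℝ) * c)
    nlinarith
  have hπ : ∀ z, π z = piH β y z := fun z => by simp only [π, piH]
  have hpn : ∀ x : Fin L → (Fin m → Bool), 0 ≤ ∏ l, piH β y (x l) := fun x =>
    Finset.prod_nonneg fun l _ => piH_nonneg hm β y _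
  simp only [hπ]
  calc _ ≤ ∑ x ∈ (Finset.univ.filter (fun t : Fin m → Bool => t ≠ y)).biUnion (fun t =>
          Finset.univ.filter (fun x : Fin L → (Fin m → Bool) =>
            ∑ l, (adjH y (x l) - adjH t (x l)) ≤ L * δ)), ∏ l, piH β y (x l) := by
        refine Finset.sum_le_sum_of_subset_of_nonneg ?_ fun x _ _ => hpn x
        intro x hx
        obtain ⟨t, ht, hft⟩ := (Finset.mem_filter.mp hx).2
        simp only [Finset.mem_biUnion, Finset.mem_filter, Finset.mem_univ, true_and]
        exact ⟨t, ht, hdet x t hft⟩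
    _ ≤ ∑ t ∈ Finset.univ.filter (fun t : Fin m → Bool => t ≠ y),
          ∑ x ∈ Finset.univ.filter (fun x : Fin L → (Fin m → Bool) =>
            ∑ l, (adjH y (x l) - adjH t (x l)) ≤ L * δ), ∏ l, piH β y (x l) := by
        exact sum_biUnion_le_H _ _ _ hpn
    _ ≤ ∑ t ∈ Finset.univ.filter (fun t : Fin m → Bool => t ≠ y), ε / 2 ^ m := by
        refine Finset.sum_le_sum fun t ht => ?_
        exact hL₀ L (le_trans (le_max_right _ _) hL) y t (Finset.mem_filter.mp ht).2
    _ ≤ ∑ t : Fin m → Bool, ε / 2 ^ m :=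
        Finset.sum_le_sum_of_subset_of_nonneg (Finset.filter_subset _ _) fun _ _ _ => by positivity
    _ = ε := by
        rw [Finset.sum_const, Finset.card_univ]
        simp
        field_simp
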